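/- For every 1 ≤ k ≤ n, every σ ∈ S_n and every ρ ∈ S_k: ∑_{τ ∈ S_n : std(τ_{n−k+1},…,τ_n) = ρ} K_n(σ,τ) = ((n−k)/n)·[ρ = std(σ_{n−k+1},…,σ_n)] + (k/n)·K_k(std(σ_{n−k+1},…,σ_n), ρ), where [·] equals 1 if the condition holds and 0 otherwise. That is, observing the standardisation of the last k entries of the top-to-random-with-standardisation chain on S_n is a Markov chain equal to the (n−k)/n-lazy version of the top-to-random-with-standardisation chain on S_k. -/

import Mathlib

open scoped Classical

noncomputable section

/-- The standardisation (rank function) of a word `w = (w 0, …, w (m-1))` of distinct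
letters from a linear order: position `a` is sent to the number of positions carrying a
smaller letter (so, `0`-indexed ranks). -/
def std {m : ℕ} {α : Type*} [LinearOrder α] (w : Fin m → α) : Fin m → Fin m :=
  fun a =>
    ⟨(Finset.univ.filter (fun b => w b < w a)).card, by
      have ha : a ∉ Finset.univ.filter (fun b => w b < w a) := by simp
      have h := Finset.card_lt_card
        ((Finset.ssubset_iff_of_subset (Finset.filter_subset _ _)).2
          ⟨a, Finset.mem_univ a, ha⟩)
      simpa using h⟩

/-- `subMatch n r σ τ` says: the subsequence of the word `(τ 0, …, τ (n-1))` consisting of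
the entries with values `≥ r` (`0`-indexed; these are the values `{r+1,…,n}` in `1`-indexed
notation) has the same standardisation as the word `(σ r, …, σ (n-1))`.
Here `g` is the (unique) strictly increasing enumeration of the relevant positions. -/
def subMatch (n r : ℕ) (σ τ : Equiv.Perm (Fin n)) : Prop :=
  ∃ g : Fin (n - r) → Fin n, StrictMono g ∧
    (∀ p : Fin n, (∃ a, g a = p) ↔ r ≤ (τ p : ℕ)) ∧
    std (fun a => τ (g a)) =
      std (fun a : Fin (n - r) => σ ⟨r + (a : ℕ), by have := a.isLt; omega⟩)

/-- The top-to-random-with-standardisation transition matrix on `S_n`. -/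
def Ktr (n : ℕ) : Matrix (Equiv.Perm (Fin n)) (Equiv.Perm (Fin n)) ℝ :=
  Matrix.of fun σ τ => if subMatch n 1 σ τ then 1 / (n : ℝ) else 0

/-- The binomial-top-to-random-with-standardisation transition matrix on `S_n`,
with parameter `q`. -/
def Kq (n : ℕ) (q : ℝ) : Matrix (Equiv.Perm (Fin n)) (Equiv.Perm (Fin n)) ℝ :=
  Matrix.of fun σ τ =>
    ∑ r ∈ Finset.range (n + 1),
      ((1 - q) ^ r * q ^ (n - r) / (r.factorial : ℝ)) *
        (if subMatch n r σ τ then 1 else 0)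

/-- The word `(σ_{j+1}, …, σ_n)` (0-indexed: the entries of `σ` at positions `j,…,n-1`). -/
def tailWord (n j : ℕ) (σ : Equiv.Perm (Fin n)) : Fin (n - j) → Fin n :=
  fun a => σ ⟨j + (a : ℕ), by have := a.isLt; omega⟩

/-- The word `(j+1, τ_{j+1}, …, τ_{i-1}, τ_{i+1}, …, τ_n)` (0-indexed: first letter the
value `j`, followed by the entries of `τ` at positions `j,…,n-1` skipping position `i`). -/
def wMinus (n j : ℕ) (i : Fin n) (τ : Equiv.Perm (Fin n)) : Fin (n - j) → Fin n :=
  fun a =>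
    if (a : ℕ) = 0 then ⟨j, by have := a.isLt; omega⟩
    else if j + (a : ℕ) - 1 < (i : ℕ) then τ ⟨j + (a : ℕ) - 1, by have := a.isLt; omega⟩
    else τ ⟨j + (a : ℕ), by have := a.isLt; omega⟩

/-- The eigenfunction `f_τ` attached to a non-identity permutation `τ`, where `j` is the
number of initial fixed points of `τ` and `i` is the position of the value `j` in `τ`. -/
def fTau (n j : ℕ) (i : Fin n) (τ σ : Equiv.Perm (Fin n)) : ℝ :=
  if std (tailWord n j σ) = std (tailWord n j τ) then 1
  else if std (tailWord n j σ) = std (wMinus n j i τ) then -1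
  else 0


theorem std_lt_std_iff {m : ℕ} {α : Type*} [LinearOrder α] (w : Fin m → α) (a b : Fin m) :
    std w a < std w b ↔ w a < w b := by
  constructor
  · contrapose!
    exact fun h => Fin.mk_le_mk.2 <| Finset.card_le_card <|
      Finset.monotone_filter_right _ fun _ _ hc => lt_of_lt_of_le hc h
  · intro h
    refine Fin.mk_lt_mk.2 <| Finset.card_lt_card <| (Finset.ssubset_iff_of_subset
      (Finset.monotone_filter_right _ fun _ _ hc => lt_trans hc h)).2 ⟨a, ?_, ?_⟩ <;> simp [h]

theorem std_eq_std_iff {m : ℕ} {α β : Type*} [LinearOrder α] [LinearOrder β]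
    (w : Fin m → α) (v : Fin m → β) :
    std w = std v ↔ ∀ a b, w a < w b ↔ v a < v b := by
  refine ⟨fun h a b => ?_, fun h => ?_⟩
  · rw [← std_lt_std_iff w, h, std_lt_std_iff]
  · ext a
    simp [std, h]

theorem std_injective {m : ℕ} {α : Type*} [LinearOrder α] {w : Fin m → α}
    (hw : Function.Injective w) : Function.Injective (std w) := by
  intro a b hab
  by_contra hne
  rcases lt_or_gt_of_ne (hw.ne hne) with h | h <;>
    exact absurd ((std_lt_std_iff w _ _).2 h) (by simp [hab])

theorem std_perm {m : ℕ} (τ : Equiv.Perm (Fin m)) : std τ = τ := by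
  ext a
  have : (Finset.univ.filter fun b => τ b < τ a) = (Finset.Iio (τ a)).map τ.symm.toEmbedding := by
    ext b
    simp [Finset.mem_map_equiv]
  simp [std, this]

/-- The permutation with the smallest value at position `p` and, at the other positions, the
pattern of `(σ 1, …, σ m)`. -/
def insertMin {m : ℕ} (σ : Equiv.Perm (Fin (m + 1))) (p : Fin (m + 1)) :
    Equiv.Perm (Fin (m + 1)) :=
  (finSuccEquiv' p).trans <| (Equiv.optionCongr <| Equiv.ofBijective
    (std fun a : Fin m => σ a.succ) <| Finite.injective_iff_bijective.1 <|
      std_injective (σ.injective.comp (Fin.succ_injective m))).trans (finSuccEquiv' 0).symm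

section insertMin

variable {m : ℕ} (σ τ : Equiv.Perm (Fin (m + 1))) (p : Fin (m + 1))

theorem insertMin_self : insertMin σ p p = 0 := by
  simp [insertMin]

theorem insertMin_succAbove (a : Fin m) :
    insertMin σ p (p.succAbove a) = (std (fun a : Fin m => σ a.succ) a).succ := by
  simp [insertMin]

theorem insertMin_succAbove_lt_iff (a b : Fin m) :
    insertMin σ p (p.succAbove a) < insertMin σ p (p.succAbove b) ↔ σ a.succ < σ b.succ := by
  rw [insertMin_succAbove, insertMin_succAbove, Fin.succ_lt_succ_iff, std_lt_std_iff]

theorem insertMin_lt_iff_of_lt {x y : Fin (m + 1)} (hx : p < x) (hy : p < y) :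
    insertMin σ p x < insertMin σ p y ↔ σ x < σ y := by
  obtain ⟨a, rfl⟩ := Fin.exists_succ_eq.2 (Fin.ne_zero_of_lt hx)
  obtain ⟨b, rfl⟩ := Fin.exists_succ_eq.2 (Fin.ne_zero_of_lt hy)
  have key := insertMin_succAbove_lt_iff σ p a b
  rwa [Fin.succAbove_of_lt_succ _ _ hx, Fin.succAbove_of_lt_succ _ _ hy] at key

theorem insertMin_injective : Function.Injective (insertMin σ) := by
  intro p q h
  apply (insertMin σ p).injective
  rw [insertMin_self, h, insertMin_self]

/-- A word with minimum at `p` is determined up to standardisation by its other letters. -/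
theorem std_eq_std_of_min {α β : Type*} [LinearOrder α] [LinearOrder β]
    {w : Fin (m + 1) → α} {v : Fin (m + 1) → β} (p : Fin (m + 1))
    (hw : ∀ a, w p < w (p.succAbove a)) (hv : ∀ a, v p < v (p.succAbove a))
    (h : ∀ a b, w (p.succAbove a) < w (p.succAbove b) ↔
      v (p.succAbove a) < v (p.succAbove b)) : std w = std v := by
  rw [std_eq_std_iff]
  intro x y
  rcases Fin.eq_self_or_eq_succAbove p x with hx | ⟨a, rfl⟩ <;>
    rcases Fin.eq_self_or_eq_succAbove p y with hy | ⟨b, rfl⟩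
  · simp [hx, hy]
  · simp [hx, hw, hv]
  · subst hy
    exact iff_of_false (hw a).not_gt (hv a).not_gt
  · exact h a b

theorem apply_lt_apply_succAbove {τ : Equiv.Perm (Fin (m + 1))} {p : Fin (m + 1)}
    (hp : τ p = 0) (a : Fin m) : τ p < τ (p.succAbove a) := by
  rw [hp, Fin.pos_iff_ne_zero, ← hp]
  exact τ.injective.ne (Fin.succAbove_ne p a)

theorem subMatch_one_iff :
    subMatch (m + 1) 1 σ τ ↔ ∃ p, insertMin σ p = τ := by
  have hσ : ∀ a : Fin m, (⟨1 + (a : ℕ), by omega⟩ : Fin (m + 1)) = a.succ := fun a => by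
    ext; simp [add_comm]
  constructor
  · rintro ⟨g, hg, hrange, hstd⟩
    change Fin m → Fin (m + 1) at g
    obtain ⟨p, hp⟩ := τ.surjective 0
    have hgp : g = p.succAbove := by
      refine (hg.range_inj (Fin.strictMono_succAbove p)).1 ?_
      rw [Fin.range_succAbove]
      ext x
      refine (hrange x).trans ?_
      rw [Set.mem_compl_singleton_iff, ← τ.injective.ne_iff, hp, Nat.one_le_iff_ne_zero,
        Fin.val_ne_zero_iff]
    refine ⟨p, DFunLike.coe_injective ?_⟩
    rw [← std_perm τ, ← std_perm (insertMin σ p)]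
    refine std_eq_std_of_min p (apply_lt_apply_succAbove (insertMin_self σ p))
      (apply_lt_apply_succAbove hp) fun a b => ?_
    rw [insertMin_succAbove_lt_iff, ← hσ, ← hσ, ← hgp]
    exact ((std_eq_std_iff _ _).1 hstd a b).symm
  · rintro ⟨p, rfl⟩
    refine ⟨p.succAbove, Fin.strictMono_succAbove p, fun x => ?_, ?_⟩
    · change x ∈ Set.range p.succAbove ↔ _
      rw [Fin.range_succAbove, Set.mem_compl_singleton_iff,
        ← (insertMin σ p).injective.ne_iff, insertMin_self, Nat.one_le_iff_ne_zero,
        Fin.val_ne_zero_iff]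
    · refine (std_eq_std_iff _ _).2 fun a b => ?_
      rw [hσ a, hσ b]
      exact insertMin_succAbove_lt_iff σ p a b

theorem sum_ite_subMatch_one (F : Equiv.Perm (Fin (m + 1)) → ℝ) :
    ∑ τ, (if subMatch (m + 1) 1 σ τ then F τ else 0) = ∑ p, F (insertMin σ p) := by
  rw [← Finset.sum_filter, ← Finset.sum_image (f := F) (insertMin_injective σ).injOn]
  congr 1
  ext τ
  simp [subMatch_one_iff]

theorem Ktr_succ_apply :
    Ktr (m + 1) σ τ = ∑ p, if insertMin σ p = τ then 1 / ((m + 1 : ℕ) : ℝ) else 0 := by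
  rw [← sum_ite_subMatch_one σ fun τ' => if τ' = τ then 1 / ((m + 1 : ℕ) : ℝ) else 0]
  rw [Finset.sum_eq_single τ (fun τ' _ h => by simp [h]) (by simp)]
  simp [Ktr]

theorem sum_filter_Ktr (P : Equiv.Perm (Fin (m + 1)) → Prop) [DecidablePred P] :
    ∑ τ ∈ Finset.univ.filter P, Ktr (m + 1) σ τ
      = ∑ p, if P (insertMin σ p) then 1 / ((m + 1 : ℕ) : ℝ) else 0 := by
  rw [← sum_ite_subMatch_one σ fun τ => if P τ then 1 / ((m + 1 : ℕ) : ℝ) else 0,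
    Finset.sum_filter]
  refine Finset.sum_congr rfl fun τ _ => ?_
  simp only [Ktr, Matrix.of_apply]
  split_ifs <;> rfl

end insertMin

theorem std_insertMin_castAdd (d l : ℕ) (σ : Equiv.Perm (Fin (d + l + 1))) (i : Fin d) :
    std (fun a : Fin (l + 1) => insertMin σ (Fin.castAdd (l + 1) i) (Fin.natAdd d a))
      = std (fun a : Fin (l + 1) => σ (Fin.natAdd d a)) :=
  (std_eq_std_iff _ _).2 fun a b => insertMin_lt_iff_of_lt σ _
    (Fin.lt_def.2 (by simp; omega)) (Fin.lt_def.2 (by simp; omega))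

theorem std_insertMin_natAdd (d l : ℕ) (σ : Equiv.Perm (Fin (d + l + 1)))
    (ρ' : Equiv.Perm (Fin (l + 1)))
    (hρ' : ⇑ρ' = std (fun a : Fin (l + 1) => σ (Fin.natAdd d a))) (q : Fin (l + 1)) :
    std (fun a : Fin (l + 1) => insertMin σ (Fin.natAdd d q) (Fin.natAdd d a))
      = insertMin ρ' q := by
  have hsucc : ∀ a : Fin l, (Fin.natAdd d (q.succAbove a) : Fin (d + l + 1))
      = Fin.succAbove (n := d + l) (Fin.natAdd d q) (Fin.natAdd d a) := fun a => by
    ext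
    simp only [Fin.succAbove, Fin.lt_def, Fin.val_natAdd, Fin.val_castSucc]
    split_ifs <;> simp_all <;> omega
  rw [← std_perm (insertMin ρ' q)]
  refine std_eq_std_of_min q (fun a => ?_)
    (apply_lt_apply_succAbove (insertMin_self ρ' q)) fun a b => ?_
  · rw [hsucc]
    exact apply_lt_apply_succAbove (insertMin_self σ _) _
  · rw [hsucc, hsucc, insertMin_succAbove_lt_iff, insertMin_succAbove_lt_iff, hρ',
      std_lt_std_iff]
    rfl

theorem sum_filter_Ktr_add (d l : ℕ) (σ : Equiv.Perm (Fin (d + (l + 1))))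
    (ρ ρ' : Equiv.Perm (Fin (l + 1)))
    (hρ' : ⇑ρ' = std (fun a : Fin (l + 1) => σ (Fin.natAdd d a))) :
    ∑ τ ∈ Finset.univ.filter (fun τ : Equiv.Perm (Fin (d + (l + 1))) =>
        std (fun a : Fin (l + 1) => τ (Fin.natAdd d a)) = ⇑ρ), Ktr (d + (l + 1)) σ τ
      = (d : ℝ) / ((d + (l + 1) : ℕ) : ℝ) * (if ρ = ρ' then 1 else 0)
        + (((l + 1 : ℕ) : ℝ) / ((d + (l + 1) : ℕ) : ℝ)) * Ktr (l + 1) ρ' ρ := by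
  have hl : ((l + 1 : ℕ) : ℝ) ≠ 0 := by positivity
  refine (sum_filter_Ktr (m := d + l) σ _).trans ?_
  refine (Fin.sum_univ_add (a := d) (b := l + 1) _).trans ?_
  congr 1
  · simp only [std_insertMin_castAdd]
    rw [← hρ']
    simp only [DFunLike.coe_fn_eq, eq_comm (a := ρ'), Finset.sum_const, Finset.card_univ,
      Fintype.card_fin, nsmul_eq_mul, add_assoc]
    split_ifs <;> ring
  · simp only [std_insertMin_natAdd d l σ ρ' hρ', DFunLike.coe_fn_eq, Ktr_succ_apply,
      Finset.mul_sum, mul_ite, mul_zero, add_assoc]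
    refine Finset.sum_congr rfl fun q _ => ?_
    congr 1
    field_simp

/-- **Recursive lumping of the top-to-random-with-standardisation chain.**  Observing the
standardisation of the last `k` entries gives the `(n-k)/n`-lazy version of the chain on
`S_k`.  Here `ρ'` is the standardisation of the last `k` entries of `σ` (given as a
permutation whose underlying function is that standardisation). -/
theorem topToRandomStd_recursive_lumping (n k : ℕ) (hk1 : 1 ≤ k) (hkn : k ≤ n)
    (σ : Equiv.Perm (Fin n)) (ρ ρ' : Equiv.Perm (Fin k))
    (hρ' : ⇑ρ' = std (fun a : Fin k => σ ⟨n - k + (a : ℕ), by have := a.isLt; omega⟩)) :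
    ∑ τ ∈ Finset.univ.filter (fun τ : Equiv.Perm (Fin n) =>
        std (fun a : Fin k => τ ⟨n - k + (a : ℕ), by have := a.isLt; omega⟩) = ⇑ρ),
      Ktr n σ τ
    = (((n : ℝ) - (k : ℝ)) / (n : ℝ)) * (if ρ = ρ' then 1 else 0)
      + ((k : ℝ) / (n : ℝ)) * Ktr k ρ' ρ := by
  obtain ⟨d, rfl⟩ := Nat.exists_eq_add_of_le' hkn
  obtain ⟨l, rfl⟩ := Nat.exists_eq_add_of_le' hk1
  simp only [Nat.add_sub_cancel] at hρ' ⊢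
  rw [Nat.cast_add d, add_sub_cancel_right, ← Nat.cast_add]
  exact sum_filter_Ktr_add d l σ ρ ρ' hρ'

end
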